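/- Let G be a thick spider graph of weight r ≥ 3 with partition (S, C, H) (S = {s_1,…,s_r} stable, C = {c_1,…,c_r} a clique, H completely joined to C, no edges between H and S, and s_i adjacent to c_j iff i ≠ j), and let G' be the thick quasi-spider graph obtained from G by adding a true twin s'_r of s_r (i.e., a new vertex s'_r adjacent to s_r and with the same neighbors as s_r outside {s_r, s'_r}). Then γ_gr^t(G') = γ_gr^t(G) + 2 = γ_gr^t(G[H]) + 6. -/

import Mathlib

/-- `s` is a legal (open neighborhood) sequence in `G`. -/
def IsLegalSeq {V : Type*} (G : SimpleGraph V) (s : List V) : Prop :=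
  s.Nodup ∧ ∀ i : Fin s.length, ∃ w : V, G.Adj (s.get i) w ∧
    ∀ j : Fin s.length, (j : ℕ) < (i : ℕ) → ¬ G.Adj (s.get j) w

/-- The Grundy total domination number: the maximum length of a legal sequence. -/
noncomputable def grundyTotal {V : Type*} (G : SimpleGraph V) : ℕ :=
  sSup {n | ∃ s : List V, IsLegalSeq G s ∧ s.length = n}

/-- A list of edges `(v, w)` of `G` in which no `v` is adjacent to the `w` of a later pair.
These are the legal sequences of `G` together with a choice of footprinted vertices. -/
def IsFootprintList {V : Type*} (G : SimpleGraph V) (l : List (V × V)) : Prop :=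
  (∀ p ∈ l, G.Adj p.1 p.2) ∧ l.Pairwise fun p q => ¬ G.Adj p.1 q.2

namespace IsFootprintList

variable {V : Type*} {G : SimpleGraph V} {l l' : List (V × V)}

lemma sublist (h : IsFootprintList G l) (hl : l'.Sublist l) : IsFootprintList G l' :=
  ⟨fun p hp => h.1 p (hl.subset hp), h.2.sublist hl⟩

lemma nodup (h : IsFootprintList G l) : l.Nodup :=
  h.2.imp_of_mem fun {a _} ha _ hab heq => hab (heq ▸ h.1 a ha)

lemma isLegalSeq_map_fst (h : IsFootprintList G l) : IsLegalSeq G (l.map Prod.fst) := by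
  constructor
  · rw [List.Nodup, List.pairwise_map]
    refine h.2.imp_of_mem fun {_ b} _ hb hab heq => hab ?_
    rw [heq]
    exact h.1 b hb
  · intro i
    have hi : (i : ℕ) < l.length := by simpa using i.2
    refine ⟨l[(i : ℕ)].2, by simpa using h.1 _ (List.getElem_mem hi), fun j hj => ?_⟩
    simpa using List.pairwise_iff_getElem.1 h.2 j i (hj.trans hi) hi hj

lemma map_val {A : Set V} {l : List (A × A)} (h : IsFootprintList (G.induce A) l) :
    IsFootprintList G (l.map (Prod.map Subtype.val Subtype.val)) := by
  refine ⟨fun p hp => ?_, List.pairwise_map.2 h.2⟩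
  obtain ⟨q, hq, rfl⟩ := List.mem_map.1 hp
  exact h.1 q hq

lemma exists_induce {A : Set V} (h : IsFootprintList G l) (hA : ∀ p ∈ l, p.1 ∈ A ∧ p.2 ∈ A) :
    ∃ l' : List (A × A), IsFootprintList (G.induce A) l' ∧ l'.length = l.length := by
  have hl : l ∈ Set.range (List.map (Prod.map (Subtype.val : A → V) (Subtype.val : A → V))) := by
    rw [Set.range_list_map]
    exact fun p hp => ⟨(⟨p.1, (hA p hp).1⟩, ⟨p.2, (hA p hp).2⟩), rfl⟩
  obtain ⟨l', rfl⟩ := hl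
  refine ⟨l', ⟨fun p hp => ?_, List.pairwise_map.1 h.2⟩, by simp⟩
  exact h.1 _ (List.mem_map_of_mem hp)

/-- If every vertex has at most one non-neighbor in `C`, then at most two vertices of a legal
sequence lie in `C`. -/
lemma length_le_two_of_fst_mem {C : Set V}
    (hC : ∀ v, ∀ a ∈ C, ∀ b ∈ C, ¬ G.Adj v a → ¬ G.Adj v b → a = b)
    (h : IsFootprintList G l) (hl : ∀ p ∈ l, p.1 ∈ C) : l.length ≤ 2 := by
  match l, h, hl with
  | [], _, _ => simp
  | [_], _, _ => simp
  | [_, _], _, _ => simp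
  | p :: q :: x :: l, h, hl =>
    have hp := h.2
    simp only [List.pairwise_cons, List.mem_cons] at hp
    have heq := hC x.2 p.1 (hl p (by simp)) q.1 (hl q (by simp))
      (fun hx => hp.1 x (by simp) hx.symm) (fun hx => hp.2.1 x (by simp) hx.symm)
    exact absurd (heq ▸ h.1 q (by simp)) (hp.1 q (by simp))

/-- If every vertex has at most one non-neighbor in `C`, then at most two footprinted vertices
lie in `C`. -/
lemma length_le_two_of_snd_mem {C : Set V}
    (hC : ∀ v, ∀ a ∈ C, ∀ b ∈ C, ¬ G.Adj v a → ¬ G.Adj v b → a = b)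
    (h : IsFootprintList G l) (hl : ∀ p ∈ l, p.2 ∈ C) : l.length ≤ 2 := by
  have hrev : IsFootprintList G (l.map Prod.swap).reverse := by
    refine ⟨fun p hp => ?_, ?_⟩
    · obtain ⟨q, hq, rfl⟩ := List.mem_map.1 (List.mem_reverse.1 hp)
      exact (h.1 q hq).symm
    · rw [List.pairwise_reverse, List.pairwise_map]
      exact h.2.imp fun hab hba => hab hba.symm
  simpa using hrev.length_le_two_of_fst_mem hC fun p hp => by
    obtain ⟨q, hq, rfl⟩ := List.mem_map.1 (List.mem_reverse.1 hp)
    exact hl q hq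

end IsFootprintList

lemma IsLegalSeq.exists_isFootprintList {V : Type*} {G : SimpleGraph V} {s : List V}
    (h : IsLegalSeq G s) : ∃ l, IsFootprintList G l ∧ l.length = s.length := by
  choose w hw hw' using h.2
  refine ⟨List.ofFn fun i => (s.get i, w i), ⟨fun p hp => ?_, ?_⟩, by simp⟩
  · obtain ⟨i, rfl⟩ := List.mem_ofFn.1 hp
    exact hw i
  · rw [List.pairwise_ofFn]
    exact fun i j hij => hw' j i hij

lemma bddAbove_length_isLegalSeq {V : Type*} [Finite V] (G : SimpleGraph V) :
    BddAbove {n | ∃ s : List V, IsLegalSeq G s ∧ s.length = n} := by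
  have := Fintype.ofFinite V
  exact ⟨Fintype.card V, by rintro _ ⟨s, hs, rfl⟩; exact hs.1.length_le_card⟩

lemma IsFootprintList.length_le_grundyTotal {V : Type*} [Finite V] {G : SimpleGraph V}
    {l : List (V × V)} (h : IsFootprintList G l) : l.length ≤ grundyTotal G :=
  le_csSup (bddAbove_length_isLegalSeq G) ⟨_, h.isLegalSeq_map_fst, by simp⟩

lemma exists_isFootprintList_length_eq_grundyTotal {V : Type*} [Finite V] (G : SimpleGraph V) :
    ∃ l, IsFootprintList G l ∧ l.length = grundyTotal G := by
  obtain ⟨s, hs, hlen⟩ := Nat.sSup_mem (s := {n | ∃ s : List V, IsLegalSeq G s ∧ s.length = n})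
    ⟨0, [], ⟨List.nodup_nil, fun i => i.elim0⟩, rfl⟩ (bddAbove_length_isLegalSeq G)
  obtain ⟨l, hl, hl'⟩ := hs.exists_isFootprintList
  exact ⟨l, hl, hl'.trans hlen⟩

/-- Suppose every vertex has at most one non-neighbor in `C`, and every edge avoiding `C` is
inside `H` or belongs to `E`. Then a legal sequence whose footprint edges are `l` has at most
four terms more than `γ_gr^t(G[H])`, apart from those with footprint edge in `E`. -/
lemma IsFootprintList.length_le_grundyTotal_induce_add {V : Type*} [Finite V]
    {G : SimpleGraph V} {l : List (V × V)} (h : IsFootprintList G l) (C H : Set V)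
    (hC : ∀ v, ∀ a ∈ C, ∀ b ∈ C, ¬ G.Adj v a → ¬ G.Adj v b → a = b)
    (E : Finset (V × V))
    (hE : ∀ p ∈ l, p.1 ∉ C → p.2 ∉ C → p ∈ E ∨ (p.1 ∈ H ∧ p.2 ∈ H)) :
    l.length ≤ grundyTotal (G.induce H) + 4 + E.card := by
  classical
  have h₁ := List.length_eq_length_filter_add (l := l) fun p => decide (p.1 ∈ C)
  set l₁ := l.filter fun p => !decide (p.1 ∈ C) with hl₁
  have h₂ := List.length_eq_length_filter_add (l := l₁) fun p => decide (p.2 ∈ C)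
  set l₂ := l₁.filter fun p => !decide (p.2 ∈ C) with hl₂
  have h₃ := List.length_eq_length_filter_add (l := l₂) fun p => decide (p ∈ E)
  set l₃ := l₂.filter fun p => !decide (p ∈ E) with hl₃
  have s₁ : l₁.Sublist l := List.filter_sublist
  have s₂ : l₂.Sublist l := List.filter_sublist.trans s₁
  have s₃ : l₃.Sublist l := List.filter_sublist.trans s₂
  have b₁ : (l.filter fun p => decide (p.1 ∈ C)).length ≤ 2 :=
    (h.sublist List.filter_sublist).length_le_two_of_fst_mem hC fun p hp => by
      simpa using (List.mem_filter.1 hp).2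
  have b₂ : (l₁.filter fun p => decide (p.2 ∈ C)).length ≤ 2 :=
    (h.sublist (List.filter_sublist.trans s₁)).length_le_two_of_snd_mem hC fun p hp => by
      simpa using (List.mem_filter.1 hp).2
  have b₃ : (l₂.filter fun p => decide (p ∈ E)).length ≤ E.card := by
    rw [← List.toFinset_card_of_nodup ((h.sublist s₂).nodup.filter _)]
    exact Finset.card_le_card fun p hp => by simp at hp; exact hp.2
  obtain ⟨l', hl', hlen⟩ := (h.sublist s₃).exists_induce (A := H) fun p hp => by
    simp only [hl₃, hl₂, hl₁, List.mem_filter, Bool.not_eq_true', decide_eq_false_iff_not] at hp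
    exact (hE p hp.1.1.1 hp.1.1.2 hp.1.2).resolve_left hp.2
  have b₄ := hl'.length_le_grundyTotal
  omega

/-- `G'` is the thick quasi-spider obtained from a thick spider of weight `r ≥ 3` with
partition `(S, C, H)` by adding a true twin `t = s'_r` of the stable-set vertex `s_r`
(the vertex `s i₀` where `i₀` is the last index). Deleting `t` recovers the thick spider `G`,
and we state `γ_gr^t(G') = γ_gr^t(G) + 2 = γ_gr^t(G[H]) + 6`. -/
theorem grundyTotal_thick_quasi_spider {V : Type*} [Fintype V] (G' : SimpleGraph V)
    (r : ℕ) (hr : 3 ≤ r) (s c : Fin r → V) (t : V) (H : Set V)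
    (i₀ : Fin r) (hi₀ : (i₀ : ℕ) = r - 1)
    -- the parts S = range s, C = range c, {t} and H form a partition of V(G'):
    (hs : Function.Injective s) (hc : Function.Injective c)
    (hsc : ∀ i j, s i ≠ c j)
    (hsH : ∀ i, s i ∉ H) (hcH : ∀ i, c i ∉ H)
    (hts : ∀ i, t ≠ s i) (htc : ∀ i, t ≠ c i) (htH : t ∉ H)
    (hcover : ∀ v : V, (∃ i, v = s i) ∨ (∃ i, v = c i) ∨ v = t ∨ v ∈ H)
    -- S is a stable set:
    (hstable : ∀ i j, ¬ G'.Adj (s i) (s j))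
    -- C is a clique:
    (hclique : ∀ i j, i ≠ j → G'.Adj (c i) (c j))
    -- H is completely joined to C:
    (hHC : ∀ v ∈ H, ∀ i, G'.Adj v (c i))
    -- no vertex of H is adjacent to a vertex of S:
    (hHS : ∀ v ∈ H, ∀ i, ¬ G'.Adj v (s i))
    -- thick spider condition:
    (hthick : ∀ i j, G'.Adj (s i) (c j) ↔ i ≠ j)
    -- t is a true twin of s_r = s i₀:
    (htwin₁ : G'.Adj t (s i₀))
    (htwin₂ : ∀ i, i ≠ i₀ → ¬ G'.Adj t (s i))
    (htwin₃ : ∀ j, G'.Adj t (c j) ↔ j ≠ i₀)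
    (htwin₄ : ∀ v ∈ H, ¬ G'.Adj t v) :
    grundyTotal G' = grundyTotal (G'.induce {v | v ≠ t}) + 2 ∧
    grundyTotal G' = grundyTotal (G'.induce H) + 6 := by
  classical
  have hC : ∀ v, ∀ a ∈ Set.range c, ∀ b ∈ Set.range c,
      ¬ G'.Adj v a → ¬ G'.Adj v b → a = b := by
    rintro v _ ⟨i, rfl⟩ _ ⟨j, rfl⟩ hi hj
    congr 1
    rcases hcover v with ⟨k, rfl⟩ | ⟨k, rfl⟩ | rfl | hv
    · rw [hthick, not_not] at hi hj
      exact hi.symm.trans hj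
    · exact (not_ne_iff.1 fun hne => hi (hclique k i hne)).symm.trans
        (not_ne_iff.1 fun hne => hj (hclique k j hne))
    · rw [htwin₃, not_not] at hi hj
      exact hi.trans hj.symm
    · exact absurd (hHC v hv i) hi
  have hedge : ∀ v w, G'.Adj v w → v ∉ Set.range c → w ∉ Set.range c →
      (v = s i₀ ∧ w = t) ∨ (v = t ∧ w = s i₀) ∨ (v ∈ H ∧ w ∈ H) := by
    intro v w hvw hv hw
    rcases hcover v with ⟨i, rfl⟩ | ⟨i, rfl⟩ | rfl | hv'
    · rcases hcover w with ⟨j, rfl⟩ | ⟨j, rfl⟩ | rfl | hw'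
      · exact absurd hvw (hstable i j)
      · exact absurd ⟨j, rfl⟩ hw
      · by_cases hi : i = i₀
        · exact Or.inl ⟨hi ▸ rfl, rfl⟩
        · exact absurd hvw.symm (htwin₂ i hi)
      · exact absurd hvw.symm (hHS w hw' i)
    · exact absurd ⟨i, rfl⟩ hv
    · rcases hcover w with ⟨j, rfl⟩ | ⟨j, rfl⟩ | rfl | hw'
      · by_cases hj : j = i₀
        · exact Or.inr (Or.inl ⟨rfl, hj ▸ rfl⟩)
        · exact absurd hvw (htwin₂ j hj)
      · exact absurd ⟨j, rfl⟩ hw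
      · exact absurd hvw G'.irrefl
      · exact absurd hvw (htwin₄ w hw')
    · rcases hcover w with ⟨j, rfl⟩ | ⟨j, rfl⟩ | rfl | hw'
      · exact absurd hvw (hHS v hv' j)
      · exact absurd ⟨j, rfl⟩ hw
      · exact absurd hvw.symm (htwin₄ v hv')
      · exact Or.inr (Or.inr ⟨hv', hw'⟩)
  have upper' : grundyTotal G' ≤ grundyTotal (G'.induce H) + 6 := by
    obtain ⟨l, hl, hlen⟩ := exists_isFootprintList_length_eq_grundyTotal G'
    have hle := hl.length_le_grundyTotal_induce_add (Set.range c) H hC {(s i₀, t), (t, s i₀)}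
      fun p hp h₁ h₂ => by
        have := hedge p.1 p.2 (hl.1 p hp) h₁ h₂
        simp only [Finset.mem_insert, Finset.mem_singleton, Prod.ext_iff]
        tauto
    have hcard := Finset.card_le_two (a := (s i₀, t)) (b := (t, s i₀))
    omega
  have upper : grundyTotal (G'.induce {v | v ≠ t}) ≤ grundyTotal (G'.induce H) + 4 := by
    obtain ⟨l, hl, hlen⟩ :=
      exists_isFootprintList_length_eq_grundyTotal (G'.induce {v | v ≠ t})
    have hle := hl.map_val.length_le_grundyTotal_induce_add (Set.range c) H hC ∅
      fun p hp h₁ h₂ => by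
        obtain ⟨q, hq, rfl⟩ := List.mem_map.1 hp
        rcases hedge _ _ (hl.1 q hq) h₁ h₂ with h | h | h
        · exact absurd h.2 q.2.2
        · exact absurd h.1 q.1.2
        · exact Or.inr h
    simpa [hlen] using hle
  obtain ⟨i, j, hij, hi, hj⟩ : ∃ i j : Fin r, i ≠ j ∧ i ≠ i₀ ∧ j ≠ i₀ := by
    refine ⟨⟨0, by omega⟩, ⟨1, by omega⟩, ?_, ?_, ?_⟩ <;> simp only [ne_eq, Fin.ext_iff] <;> omega
  obtain ⟨m, hm, hmlen⟩ := exists_isFootprintList_length_eq_grundyTotal (G'.induce H)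
  set m' := m.map (Prod.map Subtype.val Subtype.val) with hm'
  have hm'len : m'.length = grundyTotal (G'.induce H) := by simp [hm', hmlen]
  have hmem : ∀ p ∈ m', p.1 ∈ H ∧ p.2 ∈ H := by
    intro p hp
    obtain ⟨q, -, rfl⟩ := List.mem_map.1 hp
    exact ⟨q.1.2, q.2.2⟩
  have hfull : IsFootprintList G' ([(s i, c j), (s j, c i)] ++ ([(s i₀, t), (t, s i₀)] ++
      (m' ++ [(c i, s j), (c j, s i)]))) := by
    have hmap := hm.map_val
    have hHs : ∀ p ∈ m', ∀ k, ¬ G'.Adj p.1 (s k) := fun p hp k => hHS _ (hmem p hp).1 k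
    have hsH' : ∀ p ∈ m', ∀ k, ¬ G'.Adj (s k) p.2 :=
      fun p hp k h => hHS _ (hmem p hp).2 k h.symm
    have htH' : ∀ p ∈ m', ¬ G'.Adj t p.2 := fun p hp => htwin₄ _ (hmem p hp).2
    have hst : ∀ k, k ≠ i₀ → ¬ G'.Adj (s k) t := fun k hk h => htwin₂ k hk h.symm
    constructor
    · intro p hp
      simp only [List.mem_append, List.mem_cons, List.not_mem_nil, or_false] at hp
      rcases hp with (rfl | rfl) | (rfl | rfl) | hp | rfl | rfl
      · exact (hthick i j).2 hij
      · exact (hthick j i).2 hij.symm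
      · exact htwin₁.symm
      · exact htwin₁
      · exact hmap.1 p hp
      · exact ((hthick j i).2 hij.symm).symm
      · exact ((hthick i j).2 hij).symm
    · have hsplit : ∀ a b : V × V, a ∈ m' → b ∈ [(c i, s j), (c j, s i)] →
          ¬ G'.Adj a.1 b.2 := by
        intro a b ha hb
        simp only [List.mem_cons, List.not_mem_nil, or_false] at hb
        rcases hb with rfl | rfl <;> exact hHs a ha _
      have hcs : ∀ k, ¬ G'.Adj (c k) (s k) := fun k h => (hthick k k).1 h.symm rfl
      have hsc' : ∀ k, ¬ G'.Adj (s k) (c k) := fun k h => (hthick k k).1 h rfl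
      have hmp := List.pairwise_append.2
        ⟨hmap.2, by simp [hcs], fun a ha b hb => hsplit a b ha hb⟩
      simp only [List.cons_append, List.nil_append, List.pairwise_cons]
      refine ⟨?_, ?_, ?_, ?_, hmp⟩ <;> intro p hp <;>
        simp only [List.mem_append, List.mem_cons, List.not_mem_nil, or_false] at hp <;>
        grind
  have lower' := hfull.length_le_grundyTotal
  have hsub : IsFootprintList G' ([(s i, c j), (s j, c i)] ++
      (m' ++ [(c i, s j), (c j, s i)])) :=
    hfull.sublist ((List.Sublist.refl _).append (List.sublist_append_right _ _))
  obtain ⟨l, hl, hlen⟩ := hsub.exists_induce (A := {v | v ≠ t}) fun p hp => by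
    have hne : ∀ v ∈ H, v ≠ t := fun v hv h => htH (h ▸ hv)
    simp only [List.mem_append, List.mem_cons, List.not_mem_nil, or_false] at hp
    rcases hp with (rfl | rfl) | hp | rfl | rfl
    · exact ⟨(hts i).symm, (htc j).symm⟩
    · exact ⟨(hts j).symm, (htc i).symm⟩
    · exact ⟨hne _ (hmem p hp).1, hne _ (hmem p hp).2⟩
    · exact ⟨(htc i).symm, (hts j).symm⟩
    · exact ⟨(htc j).symm, (hts i).symm⟩
  have lower := hl.length_le_grundyTotal
  simp only [List.length_append, List.length_cons, List.length_nil] at lower' hlen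
  omega
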